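/- arXiv:2010.15286 — 5 statements merged into one kernel-verified Lean document; each statement's English description precedes it below -/
import Mathlib

section
/- Let (A,φ,φ') be an infinitesimal probability space and let (a_i)_{i≥1} be an infinitesimally monotone independent sequence in A with identical distribution (for every k ≥ 1, φ(a_i^k) and φ'(a_i^k) do not depend on i) satisfying φ(a_1) = φ'(a_1) = 0, φ(a_1²) = 1 and φ'(a_1²) = α. Let S_N = (a_1 + ⋯ + a_N)/√N. Then for every k ≥ 1: lim_{N→∞} φ(S_N^k) = C(k, k/2)/2^{k/2} if k is even and 0 if k is odd, and lim_{N→∞} φ'(S_N^k) = α·(k/2)·C(k, k/2)/2^{k/2} if k is even and 0 if k is odd, where C(k, k/2) denotes the central binomial coefficient (these are the moments and α·(k/2)-scaled moments of the arcsine law on (−√2,√2)). -/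
noncomputable section

open scoped BigOperators
open Filter Topology

variable {A : Type*} [Ring A] [Algebra ℂ A]

/-- The non-unital subalgebras `S i`, `i ∈ ℕ` with its natural order, are infinitesimally
monotone independent with respect to `(φ, φ')`: whenever `x_r ∈ S i_r` and
`i_{j−1} < i_j > i_{j+1}` (one inequality dropped if `j = 1` or `j = n`),
`φ(x_1⋯x_n) = φ(x_j)·φ(x_1⋯x̂_j⋯x_n)` and
`φ'(x_1⋯x_n) = φ'(x_j)·φ(x_1⋯x̂_j⋯x_n) + φ(x_j)·φ'(x_1⋯x̂_j⋯x_n)`. -/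
def InfMonotoneSeq (φ φ' : A → ℂ) (S : ℕ → NonUnitalSubalgebra ℂ A) : Prop :=
  ∀ (n : ℕ) (idx : Fin n → ℕ) (j : Fin n),
    (∀ k : Fin n, k.val + 1 = j.val → idx k < idx j) →
    (∀ k : Fin n, j.val + 1 = k.val → idx k < idx j) →
    ∀ x : Fin n → A, (∀ k, x k ∈ S (idx k)) →
      φ (List.ofFn x).prod = φ (x j) * φ ((List.ofFn x).eraseIdx j.val).prod ∧
      φ' (List.ofFn x).prod =
        φ' (x j) * φ ((List.ofFn x).eraseIdx j.val).prod +
        φ (x j) * φ' ((List.ofFn x).eraseIdx j.val).prod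

section PeakFactorization

variable {R : Type*} [CommRing R] [Algebra ℂ R]

/-- A functional factorizes at peaks of the sequence `a` if powers of the largest letter can be
pulled out of a word whenever the adjacent letters have strictly smaller index. -/
def FactorsAtPeaks (Ψ : A →ₗ[ℂ] R) (a : ℕ → A) : Prop :=
  ∀ (l₁ l₂ : List ℕ) (N p : ℕ), (∀ i ∈ l₁, i < N) → (∀ i ∈ l₂.head?, i < N) →
    Ψ ((l₁.map a).prod * a N ^ p * (l₂.map a).prod) =
      Ψ (a N ^ p) * Ψ ((l₁.map a).prod * (l₂.map a).prod)

theorem exists_list_of_mem_closure_image {M ι : Type*} [Monoid M] {a : ι → M} {s : Set ι} {y : M}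
    (hy : y ∈ Submonoid.closure (a '' s)) :
    ∃ l : List ι, (∀ i ∈ l, i ∈ s) ∧ (l.map a).prod = y := by
  induction hy using Submonoid.closure_induction with
  | mem x hx =>
    obtain ⟨i, hi, rfl⟩ := hx
    exact ⟨[i], by simpa using hi, by simp⟩
  | one => exact ⟨[], by simp, by simp⟩
  | mul x y _ _ hx hy =>
    obtain ⟨l, hl, rfl⟩ := hx
    obtain ⟨l', hl', rfl⟩ := hy
    refine ⟨l ++ l', fun i hi => ?_, by simp⟩
    rcases List.mem_append.1 hi with h | h
    exacts [hl i h, hl' i h]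

theorem FactorsAtPeaks.map_mul_pow_mul_mul {Ψ : A →ₗ[ℂ] R} {a : ℕ → A}
    (h : FactorsAtPeaks Ψ a) {N : ℕ} (p : ℕ) {y z : A}
    (hy : y ∈ Algebra.adjoin ℂ (a '' Set.Iio N)) (hz : z ∈ Algebra.adjoin ℂ (Set.range a))
    {i : ℕ} (hi : i < N) :
    Ψ (y * a N ^ p * (a i * z)) = Ψ (a N ^ p) * Ψ (y * (a i * z)) := by
  rw [← Subalgebra.mem_toSubmodule, Algebra.adjoin_eq_span] at hy hz
  induction hy using Submodule.span_induction with
  | zero => simp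
  | add x y _ _ hx hy => simp only [add_mul, map_add, hx, hy, mul_add]
  | smul c x _ hx => simp only [smul_mul_assoc, map_smul, hx, mul_smul_comm]
  | mem y hy =>
    induction hz using Submodule.span_induction with
    | zero => simp
    | add x y _ _ hx hy => simp only [map_add, hx, hy, mul_add]
    | smul c x _ hx => simp only [map_smul, hx, mul_smul_comm]
    | mem z hz =>
      obtain ⟨l₁, hl₁, rfl⟩ := exists_list_of_mem_closure_image hy
      rw [← Set.image_univ] at hz
      obtain ⟨l₂, -, rfl⟩ := exists_list_of_mem_closure_image hz
      simpa using h l₁ (i :: l₂) N p hl₁ (by simpa using hi)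

theorem FactorsAtPeaks.map_mul_pow {Ψ : A →ₗ[ℂ] R} {a : ℕ → A}
    (h : FactorsAtPeaks Ψ a) {N : ℕ} (p : ℕ) {y : A}
    (hy : y ∈ Algebra.adjoin ℂ (a '' Set.Iio N)) :
    Ψ (y * a N ^ p) = Ψ (a N ^ p) * Ψ y := by
  rw [← Subalgebra.mem_toSubmodule, Algebra.adjoin_eq_span] at hy
  induction hy using Submodule.span_induction with
  | zero => simp
  | add x y _ _ hx hy => simp only [add_mul, map_add, hx, hy, mul_add]
  | smul c x _ hx => simp only [smul_mul_assoc, map_smul, hx, mul_smul_comm]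
  | mem y hy =>
    obtain ⟨l₁, hl₁, rfl⟩ := exists_list_of_mem_closure_image hy
    simpa using h l₁ [] N p hl₁ (by simp)

/-- Expansion of a noncommutative binomial according to the first occurrence of `s`. -/
theorem add_pow_succ_eq_sum_antidiagonal {B : Type*} [Semiring B] (s b : B) (k : ℕ) :
    (s + b) ^ (k + 1) =
      b ^ (k + 1) + ∑ x ∈ Finset.HasAntidiagonal.antidiagonal k, b ^ x.1 * (s * (s + b) ^ x.2) := by
  induction k with
  | zero => simp [add_comm]
  | succ k ih =>
    have hsum : ∑ x ∈ Finset.HasAntidiagonal.antidiagonal k, b ^ (x.1 + 1) * (s * (s + b) ^ x.2) =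
        b * ∑ x ∈ Finset.HasAntidiagonal.antidiagonal k, b ^ x.1 * (s * (s + b) ^ x.2) := by
      simp only [Finset.mul_sum, pow_succ', mul_assoc]
    rw [Finset.Nat.sum_antidiagonal_succ, hsum, pow_succ', add_mul]
    nth_rewrite 2 [ih]
    rw [mul_add, ← pow_succ' b (k + 1), pow_zero, one_mul, add_left_comm]

theorem sum_range_mem_adjoin (a : ℕ → A) (N : ℕ) :
    ∑ i ∈ Finset.range N, a i ∈ Algebra.adjoin ℂ (a '' Set.Iio N) :=
  sum_mem fun i hi => Algebra.subset_adjoin ⟨i, Finset.mem_range.1 hi, rfl⟩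

open PowerSeries in
/-- The moments of the partial sums satisfy the recursion of iterated monotone convolution. -/
theorem FactorsAtPeaks.map_sum_range_succ_pow {Ψ : A →ₗ[ℂ] R} {a : ℕ → A}
    (h : FactorsAtPeaks Ψ a) (hΨ : Ψ 1 = 1) {μ : ℕ → R} (hμ : ∀ i p, Ψ (a i ^ p) = μ p)
    (N k : ℕ) :
    Ψ ((∑ i ∈ Finset.range (N + 1), a i) ^ k) =
      ∑ r ∈ Finset.range (k + 1),
        coeff (k - r) (PowerSeries.mk μ ^ (r + 1)) * Ψ ((∑ i ∈ Finset.range N, a i) ^ r) := by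
  rw [Finset.sum_range_succ]
  set s := ∑ i ∈ Finset.range N, a i with hs
  set M : R⟦X⟧ := PowerSeries.mk μ with hM
  let G : ℕ → R⟦X⟧ := fun i => PowerSeries.mk fun k => Ψ (s ^ i * (s + a N) ^ k)
  have hs_pow (i : ℕ) : s ^ i ∈ Algebra.adjoin ℂ (a '' Set.Iio N) :=
    pow_mem (sum_range_mem_adjoin a N) i
  have hmono : Algebra.adjoin ℂ (a '' Set.Iio N) ≤ Algebra.adjoin ℂ (Set.range a) :=
    Algebra.adjoin_mono (Set.image_subset_range _ _)
  have hsb (q : ℕ) : (s + a N) ^ q ∈ Algebra.adjoin ℂ (Set.range a) :=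
    pow_mem (add_mem (hmono (sum_range_mem_adjoin a N)) (Algebra.subset_adjoin ⟨N, rfl⟩)) q
  have hfactor (i p q : ℕ) : Ψ (s ^ i * (a N ^ p * (s * (s + a N) ^ q))) =
      μ p * Ψ (s ^ (i + 1) * (s + a N) ^ q) := by
    have hsum : s * (s + a N) ^ q = ∑ j ∈ Finset.range N, a j * (s + a N) ^ q := by
      rw [← Finset.sum_mul]
    rw [pow_succ, mul_assoc (s ^ i), hsum]
    simp only [Finset.mul_sum, map_sum]
    refine Finset.sum_congr rfl fun j hj => ?_
    rw [← mul_assoc, h.map_mul_pow_mul_mul p (hs_pow i) (hsb q) (Finset.mem_range.1 hj), hμ]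
  have hG (i : ℕ) : G i = C (Ψ (s ^ i)) * M + X * M * G (i + 1) := by
    ext k
    rw [map_add, coeff_C_mul, mul_assoc X]
    cases k with
    | zero =>
      have hμ0 : μ 0 = 1 := by rw [← hμ 0 0, pow_zero, hΨ]
      simp [G, hM, hμ0]
    | succ k =>
      rw [coeff_succ_X_mul, coeff_mul]
      simp only [G, hM, coeff_mk]
      rw [add_pow_succ_eq_sum_antidiagonal, mul_add, map_add, h.map_mul_pow _ (hs_pow i), hμ,
        mul_comm, Finset.mul_sum, map_sum]
      simp only [hfactor]
  have hGsum (n : ℕ) : G 0 = ∑ r ∈ Finset.range n, X ^ r * (C (Ψ (s ^ r)) * M ^ (r + 1)) +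
      X ^ n * (M ^ n * G n) := by
    induction n with
    | zero => simp
    | succ n ih =>
      rw [ih, Finset.sum_range_succ, hG n]
      ring
  have hcoeff := congrArg (coeff k) (hGsum (k + 1))
  rw [map_add, map_sum, coeff_X_pow_mul', if_neg (by omega), add_zero] at hcoeff
  simp only [G, coeff_mk, pow_zero, one_mul] at hcoeff
  rw [hcoeff]
  refine Finset.sum_congr rfl fun r hr => ?_
  rw [coeff_X_pow_mul', if_pos (by simpa [Nat.lt_succ_iff] using hr), coeff_C_mul, mul_comm]

end PeakFactorization

section Recursion

variable {R : Type*} [CommRing R]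

open PowerSeries in
theorem coeff_pow_of_coeff_one_eq_zero {M : R⟦X⟧} (h0 : coeff 0 M = 1) (h1 : coeff 1 M = 0)
    (n : ℕ) : coeff 0 (M ^ n) = 1 ∧ coeff 1 (M ^ n) = 0 ∧
      coeff 2 (M ^ n) = n * coeff 2 M := by
  induction n with
  | zero => simp [coeff_one]
  | succ n ih =>
    obtain ⟨i0, i1, i2⟩ := ih
    refine ⟨?_, ?_, ?_⟩ <;> rw [pow_succ, coeff_mul]
    · simp only [Finset.Nat.antidiagonal_zero, Finset.sum_singleton, i0, h0, one_mul]
    · simp only [Finset.Nat.sum_antidiagonal_succ, Finset.Nat.antidiagonal_zero, Finset.sum_singleton,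
        zero_add, i0, i1, h0, h1]
      simp
    · simp only [Finset.Nat.sum_antidiagonal_succ, Finset.Nat.antidiagonal_zero, Finset.sum_singleton,
        zero_add, Nat.reduceAdd, i0, i1, i2, h0, h1]
      push_cast
      ring

/-- Coefficients, in the basis of binomial coefficients `N.choose j`, of the solution of the linear
recursion with matrix `c`. -/
def binomialCoeff (c : ℕ → ℕ → R) : ℕ → ℕ → R
  | 0, k => if k = 0 then 1 else 0
  | j + 1, k => ∑ r ∈ Finset.range k, c k r * binomialCoeff c j r

theorem binomialCoeff_eq_zero_of_lt (c : ℕ → ℕ → R) {j k : ℕ} (hjk : k < j) :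
    binomialCoeff c j k = 0 := by
  induction j generalizing k with
  | zero => omega
  | succ j ih =>
    refine Finset.sum_eq_zero fun r hr => ?_
    rw [ih (by have := Finset.mem_range.1 hr; omega), mul_zero]

theorem eq_sum_choose_of_recursion {c : ℕ → ℕ → R} (hc : ∀ k, c k k = 1) {m : ℕ → ℕ → R}
    (hm0 : ∀ k, m 0 k = if k = 0 then 1 else 0)
    (hm : ∀ N k, m (N + 1) k = ∑ r ∈ Finset.range (k + 1), c k r * m N r) (N k : ℕ) :
    m N k = ∑ j ∈ Finset.range (k + 1), N.choose j • binomialCoeff c j k := by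
  induction N generalizing k with
  | zero =>
    rw [hm0, Finset.sum_range_succ']
    simp [binomialCoeff]
  | succ N ih =>
    have hlower : ∑ r ∈ Finset.range k, c k r * m N r =
        ∑ j ∈ Finset.range k, N.choose j • binomialCoeff c (j + 1) k := by
      simp only [binomialCoeff, Finset.smul_sum]
      rw [Finset.sum_comm]
      refine Finset.sum_congr rfl fun r hr => ?_
      have hsub : Finset.range (r + 1) ⊆ Finset.range k :=
        Finset.range_subset_range.2 (Finset.mem_range.1 hr)
      rw [ih r, Finset.mul_sum, Finset.sum_subset hsub]
      · simp only [mul_smul_comm]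
      · intro j _ hj
        rw [binomialCoeff_eq_zero_of_lt c (by simpa [Nat.lt_succ_iff] using hj), smul_zero,
          mul_zero]
    rw [hm, Finset.sum_range_succ, hlower, hc, one_mul, ih k, Finset.sum_range_succ',
      Finset.sum_range_succ' _ k]
    simp only [Nat.choose_succ_succ, add_smul, Finset.sum_add_distrib, Nat.choose_zero_right]
    abel

theorem binomialCoeff_eq_zero_of_lt_two_mul {c : ℕ → ℕ → R} (hc : ∀ k, c (k + 1) k = 0) {j k : ℕ}
    (hjk : k < 2 * j) : binomialCoeff c j k = 0 := by
  induction j generalizing k with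
  | zero => omega
  | succ j ih =>
    refine Finset.sum_eq_zero fun r hr => ?_
    have hr := Finset.mem_range.1 hr
    by_cases hrk : k = r + 1
    · rw [hrk, hc, zero_mul]
    · rw [ih (by omega), mul_zero]

theorem factorial_mul_binomialCoeff {c : ℕ → ℕ → R} (hc : ∀ k, c (k + 1) k = 0) {β : R}
    (hc2 : ∀ k, c (k + 2) k = (k + 1) * β) (j : ℕ) :
    2 ^ j * (j.factorial : R) * binomialCoeff c j (2 * j) = (2 * j).factorial * β ^ j := by
  induction j with
  | zero => simp [binomialCoeff]
  | succ j ih =>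
    have hstep : binomialCoeff c (j + 1) (2 * (j + 1)) =
        (2 * j + 1) * β * binomialCoeff c j (2 * j) := by
      rw [binomialCoeff, Finset.sum_eq_single (2 * j)]
      · rw [mul_add, mul_one, hc2]
        push_cast
        ring
      · intro r hr hne
        have hr := Finset.mem_range.1 hr
        by_cases hrj : r = 2 * j + 1
        · rw [hrj, mul_add, mul_one, hc, zero_mul]
        · rw [binomialCoeff_eq_zero_of_lt_two_mul hc (by omega), mul_zero]
      · intro hn
        exact absurd (Finset.mem_range.2 (by omega)) hn
    rw [hstep, Nat.factorial_succ, mul_add, mul_one, Nat.factorial_succ, Nat.factorial_succ]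
    push_cast
    linear_combination (2 * (j + 1) * (2 * j + 1) * β : R) * ih

end Recursion

section Limits

theorem tendsto_choose_div_pow (j : ℕ) :
    Tendsto (fun N : ℕ => (N.choose j : ℝ) / (N : ℝ) ^ j) atTop (𝓝 (1 / j.factorial)) := by
  have h := ProbabilityTheory.tendsto_choose_mul_pow_atTop (p := fun n : ℕ => (n : ℝ)⁻¹) (r := 1) j
    (tendsto_const_nhds.congr' ?_)
  · simpa [div_eq_mul_inv] using h
  · filter_upwards [eventually_ne_atTop 0] with n hn
    rw [mul_inv_cancel₀ (Nat.cast_ne_zero.2 hn)]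

theorem tendsto_choose_div_sqrt_pow {j k : ℕ} (hjk : 2 * j ≤ k) :
    Tendsto (fun N : ℕ => ((Real.sqrt N : ℂ))⁻¹ ^ k * (N.choose j : ℂ)) atTop
      (𝓝 (if k = 2 * j then 1 / (j.factorial : ℂ) else 0)) := by
  have hreal : Tendsto (fun N : ℕ => (Real.sqrt N)⁻¹ ^ k * (N.choose j : ℝ)) atTop
      (𝓝 (if k = 2 * j then 1 / (j.factorial : ℝ) else 0)) := by
    obtain ⟨d, rfl⟩ := Nat.exists_eq_add_of_le hjk
    have hsqrt : Tendsto (fun N : ℕ => (Real.sqrt N)⁻¹ ^ d) atTop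
        (𝓝 (if d = 0 then 1 else 0)) := by
      have := (tendsto_inv_atTop_zero.comp
        (Real.tendsto_sqrt_atTop.comp (tendsto_natCast_atTop_atTop (R := ℝ)))).pow d
      simpa [zero_pow_eq] using this
    have hmul := hsqrt.mul (tendsto_choose_div_pow j)
    have hlim : (if d = 0 then (1 : ℝ) else 0) * (1 / j.factorial) =
        if 2 * j + d = 2 * j then 1 / (j.factorial : ℝ) else 0 := by
      simp
    rw [hlim] at hmul
    refine hmul.congr fun N => ?_
    rw [pow_add, pow_mul, inv_pow (Real.sqrt N) 2, Real.sq_sqrt (Nat.cast_nonneg N), inv_pow,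
      div_eq_mul_inv]
    ring
  have := (Complex.continuous_ofReal.tendsto _).comp hreal
  refine (this.congr fun N => ?_).trans (le_of_eq ?_)
  · simp
  · split_ifs <;> simp

theorem tendsto_sum_choose {f : ℕ → ℂ} {k : ℕ} (hf : ∀ j, k < 2 * j → f j = 0) :
    Tendsto (fun N : ℕ => ((Real.sqrt N : ℂ))⁻¹ ^ k *
        ∑ j ∈ Finset.range (k + 1), N.choose j • f j) atTop
      (𝓝 (if Even k then f (k / 2) / (k / 2).factorial else 0)) := by
  have hterm (j : ℕ) : Tendsto (fun N : ℕ => ((Real.sqrt N : ℂ))⁻¹ ^ k * (N.choose j • f j)) atTop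
      (𝓝 (if k = 2 * j then f j / j.factorial else 0)) := by
    rcases lt_or_ge k (2 * j) with hj | hj
    · simp [hf j hj]
    · refine ((tendsto_choose_div_sqrt_pow hj).mul_const (f j)).congr' ?_ |>.trans (le_of_eq ?_)
      · exact .of_forall fun N => by simp [mul_assoc]
      · split_ifs
        · rw [one_div, div_eq_mul_inv, mul_comm]
        · simp
  simp only [Finset.mul_sum]
  refine (tendsto_finsetSum _ fun j _ => hterm j).trans (le_of_eq ?_)
  congr 1
  by_cases hk : Even k
  · obtain ⟨m, rfl⟩ := hk
    rw [Finset.sum_eq_single m]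
    · rw [if_pos (by omega), if_pos ⟨m, rfl⟩, show (m + m) / 2 = m by omega]
    · intro j _ hj
      exact if_neg (by omega)
    · intro hm
      exact absurd (Finset.mem_range.2 (by omega)) hm
  · rw [if_neg hk]
    refine Finset.sum_eq_zero fun j _ => if_neg fun hj => hk ⟨j, by omega⟩

end Limits

/-- The dual-number valued functional `φ + ε φ'`. -/
def dualFunctional (φ φ' : A →ₗ[ℂ] ℂ) : A →ₗ[ℂ] DualNumber ℂ where
  toFun x := TrivSqZeroExt.inl (φ x) + TrivSqZeroExt.inr (φ' x)
  map_add' x y := by ext <;> simp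
  map_smul' c x := by ext <;> simp

@[simp] theorem fst_dualFunctional (φ φ' : A →ₗ[ℂ] ℂ) (x : A) :
    (dualFunctional φ φ' x).fst = φ x := by
  simp [dualFunctional]

@[simp] theorem snd_dualFunctional (φ φ' : A →ₗ[ℂ] ℂ) (x : A) :
    (dualFunctional φ φ' x).snd = φ' x := by
  simp [dualFunctional]

theorem InfMonotoneSeq.dualFunctional_prod {φ φ' : A →ₗ[ℂ] ℂ}
    {S : ℕ → NonUnitalSubalgebra ℂ A} (h : InfMonotoneSeq φ φ' S) {l₁ l₂ : List (ℕ × A)}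
    {i : ℕ} {x : A} (hx : x ∈ S i) (hS₁ : ∀ w ∈ l₁, w.2 ∈ S w.1) (hS₂ : ∀ w ∈ l₂, w.2 ∈ S w.1)
    (h₁ : ∀ w ∈ l₁, w.1 < i) (h₂ : ∀ w ∈ l₂.head?, w.1 < i) :
    dualFunctional φ φ' ((l₁.map Prod.snd).prod * x * (l₂.map Prod.snd).prod) =
      dualFunctional φ φ' x *
        dualFunctional φ φ' ((l₁.map Prod.snd).prod * (l₂.map Prod.snd).prod) := by
  let L := l₁ ++ (i, x) :: l₂
  have hLS : ∀ w ∈ L, w.2 ∈ S w.1 := by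
    intro w hw
    rcases List.mem_append.1 hw with hw | hw
    · exact hS₁ w hw
    · rcases List.mem_cons.1 hw with rfl | hw
      exacts [hx, hS₂ w hw]
  have hlen : l₁.length < L.length := by simp [L]
  have hLi : L[l₁.length] = (i, x) := by simp [L]
  have hofFn : List.ofFn (fun k : Fin L.length => L[k].2) = L.map Prod.snd := by
    apply List.ext_getElem <;> simp
  have herase : (L.map Prod.snd).eraseIdx l₁.length = l₁.map Prod.snd ++ l₂.map Prod.snd := by
    simp [L, List.eraseIdx_append_of_length_le]
  obtain ⟨e, e'⟩ := h L.length (fun k => L[k].1) ⟨l₁.length, hlen⟩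
    (by
      rintro ⟨k, hk⟩ hkj
      have hk' : k < l₁.length := by simp only at hkj; omega
      have : L[k] = l₁[k] := List.getElem_append_left hk'
      simp only [Fin.getElem_fin, hLi, this]
      exact h₁ _ (List.getElem_mem hk'))
    (by
      rintro ⟨k, hk⟩ hkj
      simp only at hkj
      subst hkj
      cases l₂ with
      | nil => simp [L] at hk
      | cons w l₂ =>
        simp only [Fin.getElem_fin, hLi]
        simpa [L, List.getElem_append_right] using h₂)
    (fun k => L[k].2) (fun k => hLS _ (List.getElem_mem _))
  rw [hofFn, herase] at e e'
  simp only [Fin.getElem_fin, hLi, List.prod_append] at e e'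
  have hprod : (L.map Prod.snd).prod = (l₁.map Prod.snd).prod * x * (l₂.map Prod.snd).prod := by
    simp [L, mul_assoc]
  rw [hprod] at e e'
  ext
  · simpa using e
  · simp only [snd_dualFunctional, e', TrivSqZeroExt.snd_mul, fst_dualFunctional, smul_eq_mul,
      MulOpposite.smul_eq_mul_unop, MulOpposite.unop_op]
    ring

theorem InfMonotoneSeq.factorsAtPeaks {φ φ' : A →ₗ[ℂ] ℂ} {a : ℕ → A}
    (h : InfMonotoneSeq φ φ' fun i => NonUnitalAlgebra.adjoin ℂ {a i})
    (h1 : dualFunctional φ φ' 1 = 1) : FactorsAtPeaks (dualFunctional φ φ') a := by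
  intro l₁ l₂ N p hl₁ hl₂
  rcases Nat.eq_zero_or_pos p with rfl | hp
  · simp [h1]
  have ha (i : ℕ) : a i ∈ NonUnitalAlgebra.adjoin ℂ {a i} :=
    NonUnitalAlgebra.subset_adjoin ℂ (Set.mem_singleton _)
  have hpow : a N ^ p ∈ NonUnitalAlgebra.adjoin ℂ {a N} := by
    induction p, hp using Nat.le_induction with
    | base => simp
    | succ p _ ih => exact pow_succ (a N) p ▸ mul_mem ih (ha N)
  have := h.dualFunctional_prod (l₁ := l₁.map fun i => (i, a i)) (l₂ := l₂.map fun i => (i, a i))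
    hpow (by simp [ha]) (by simp [ha]) (by simpa using hl₁) (by simpa using hl₂)
  simpa [Function.comp_def] using this

theorem fst_pow_of_fst_eq_one {β : DualNumber ℂ} (hβ : β.fst = 1) (m : ℕ) :
    (β ^ m).fst = 1 ∧ (β ^ m).snd = m * β.snd := by
  simp [TrivSqZeroExt.snd_pow, hβ]

/-- Theorem (infinitesimal monotone CLT, moment form): for an infinitesimally monotone
independent, identically distributed sequence `(aᵢ)` with `φ(a₁) = φ'(a₁) = 0`,
`φ(a₁²) = 1`, `φ'(a₁²) = α`, the moments of `S_N = (a₁+⋯+a_N)/√N` converge to the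
arcsine moments `C(k, k/2)/2^{k/2}` for even `k` (and `0` for odd `k`), and the
infinitesimal moments converge to `α·(k/2)·C(k, k/2)/2^{k/2}` for even `k` (and `0` for
odd `k`). -/
theorem infinitesimal_monotone_clt
    (φ φ' : A →ₗ[ℂ] ℂ) (hφ1 : φ 1 = 1) (hφ'1 : φ' 1 = 0)
    (a : ℕ → A) (α : ℂ)
    (hindep : InfMonotoneSeq ⇑φ ⇑φ' fun i => NonUnitalAlgebra.adjoin ℂ {a i})
    (hident : ∀ k : ℕ, 1 ≤ k → ∀ i j : ℕ, φ (a i ^ k) = φ (a j ^ k) ∧ φ' (a i ^ k) = φ' (a j ^ k))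
    (h1 : φ (a 0) = 0) (h1' : φ' (a 0) = 0)
    (h2 : φ (a 0 ^ 2) = 1) (h2' : φ' (a 0 ^ 2) = α)
    (k : ℕ) (hk : 1 ≤ k) :
    Tendsto
      (fun N : ℕ => φ ((((Real.sqrt N : ℂ))⁻¹ • ∑ i ∈ Finset.range N, a i) ^ k))
      atTop (𝓝 (if Even k then ((k.choose (k / 2) : ℂ)) / 2 ^ (k / 2) else 0)) ∧
    Tendsto
      (fun N : ℕ => φ' ((((Real.sqrt N : ℂ))⁻¹ • ∑ i ∈ Finset.range N, a i) ^ k))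
      atTop
      (𝓝 (if Even k then α * ((k / 2 : ℕ) : ℂ) * (k.choose (k / 2) : ℂ) / 2 ^ (k / 2) else 0)) := by
  set Ψ := dualFunctional φ φ' with hΨ
  have hΨ1 : Ψ 1 = 1 := by ext <;> simp [hΨ, hφ1, hφ'1]
  let μ : ℕ → DualNumber ℂ := fun p => Ψ (a 0 ^ p)
  have hμ (i p : ℕ) : Ψ (a i ^ p) = μ p := by
    rcases Nat.eq_zero_or_pos p with rfl | hp
    · simp [μ]
    · ext
      · simpa [μ, hΨ] using (hident p hp i 0).1
      · simpa [μ, hΨ] using (hident p hp i 0).2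
  let M := PowerSeries.mk μ
  have hM0 : PowerSeries.coeff 0 M = 1 := by
    rw [PowerSeries.coeff_mk]
    simpa [μ] using hΨ1
  have hM1 : PowerSeries.coeff 1 M = 0 := by
    rw [PowerSeries.coeff_mk]
    ext
    · simpa [μ, hΨ] using h1
    · simpa [μ, hΨ] using h1'
  let c : ℕ → ℕ → DualNumber ℂ := fun k r => PowerSeries.coeff (k - r) (M ^ (r + 1))
  have hc0 (k : ℕ) : c k k = 1 := by
    simpa [c] using (coeff_pow_of_coeff_one_eq_zero hM0 hM1 (k + 1)).1
  have hc1 (k : ℕ) : c (k + 1) k = 0 := by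
    simpa [c] using (coeff_pow_of_coeff_one_eq_zero hM0 hM1 (k + 1)).2.1
  have hc2 (k : ℕ) : c (k + 2) k = (k + 1) * μ 2 := by
    simpa [c, M] using (coeff_pow_of_coeff_one_eq_zero hM0 hM1 (k + 1)).2.2
  have hmoment (N : ℕ) : Ψ ((∑ i ∈ Finset.range N, a i) ^ k) =
      ∑ j ∈ Finset.range (k + 1), N.choose j • binomialCoeff c j k := by
    refine eq_sum_choose_of_recursion (m := fun N k => Ψ ((∑ i ∈ Finset.range N, a i) ^ k)) hc0
      (fun k => ?_) (fun N k => ?_) N k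
    · rcases Nat.eq_zero_or_pos k with rfl | hk
      · simpa using hΨ1
      · simp [hk.ne']
    · exact (hindep.factorsAtPeaks hΨ1).map_sum_range_succ_pow hΨ1 hμ N k
  have hlead (m : ℕ) : (2 : ℂ) ^ m * m.factorial * (binomialCoeff c m (2 * m)).fst =
        (2 * m).factorial ∧
      (2 : ℂ) ^ m * m.factorial * (binomialCoeff c m (2 * m)).snd =
        (2 * m).factorial * (m * α) := by
    have h := factorial_mul_binomialCoeff hc1 hc2 m
    have hβ : (μ 2).fst = 1 := by simpa [μ, hΨ] using h2
    have hβ' : (μ 2).snd = α := by simpa [μ, hΨ] using h2'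
    obtain ⟨p1, p2⟩ := fst_pow_of_fst_eq_one hβ m
    have h' : (2 ^ m * m.factorial) • binomialCoeff c m (2 * m) =
        (2 * m).factorial • μ 2 ^ m := by
      rw [nsmul_eq_mul, nsmul_eq_mul, ← h]
      push_cast
      ring
    have hf := congrArg TrivSqZeroExt.fst h'
    have hs := congrArg TrivSqZeroExt.snd h'
    rw [TrivSqZeroExt.fst_smul, TrivSqZeroExt.fst_smul, p1] at hf
    rw [TrivSqZeroExt.snd_smul, TrivSqZeroExt.snd_smul, p2, hβ'] at hs
    simp only [nsmul_eq_mul] at hf hs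
    push_cast at hf hs
    exact ⟨by linear_combination hf, by linear_combination hs⟩
  have hchoose (m : ℕ) : ((2 * m).choose m : ℂ) * (m.factorial * m.factorial) =
      (2 * m).factorial := by
    have h := Nat.choose_mul_factorial_mul_factorial (n := 2 * m) (k := m) (by omega)
    rw [show 2 * m - m = m by omega] at h
    exact_mod_cast (mul_assoc _ _ _).symm.trans h
  constructor
  · have hlim := tendsto_sum_choose (f := fun j => (binomialCoeff c j k).fst) (k := k)
      fun j hj => by simp [binomialCoeff_eq_zero_of_lt_two_mul hc1 hj]
    refine (hlim.congr fun N => ?_).trans (le_of_eq ?_)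
    · have h := congrArg TrivSqZeroExt.fst (hmoment N)
      rw [TrivSqZeroExt.fst_sum, fst_dualFunctional] at h
      simp only [TrivSqZeroExt.fst_smul] at h
      rw [smul_pow, map_smul, h, smul_eq_mul]
    · congr 1
      split_ifs with hk
      · obtain ⟨m, rfl⟩ := even_iff_two_dvd.1 hk
        have hm : (m.factorial : ℂ) ≠ 0 := Nat.cast_ne_zero.2 m.factorial_ne_zero
        rw [show 2 * m / 2 = m by omega, div_eq_div_iff hm (by simp)]
        apply mul_right_cancel₀ hm
        linear_combination (hlead m).1 - hchoose m
      · rfl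
  · have hlim := tendsto_sum_choose (f := fun j => (binomialCoeff c j k).snd) (k := k)
      fun j hj => by simp [binomialCoeff_eq_zero_of_lt_two_mul hc1 hj]
    refine (hlim.congr fun N => ?_).trans (le_of_eq ?_)
    · have h := congrArg TrivSqZeroExt.snd (hmoment N)
      rw [TrivSqZeroExt.snd_sum, snd_dualFunctional] at h
      simp only [TrivSqZeroExt.snd_smul] at h
      rw [smul_pow, map_smul, h, smul_eq_mul]
    · congr 1
      split_ifs with hk
      · obtain ⟨m, rfl⟩ := even_iff_two_dvd.1 hk
        have hm : (m.factorial : ℂ) ≠ 0 := Nat.cast_ne_zero.2 m.factorial_ne_zero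
        rw [show 2 * m / 2 = m by omega, div_eq_div_iff hm (by simp)]
        apply mul_right_cancel₀ hm
        linear_combination (hlead m).2 - m * α * hchoose m
      · rfl
end
end

section
/- Let (m_n)_{n≥1} and (m'_n)_{n≥1} be the scalar sequences m_n = 1 if n is even and m_n = 0 if n is odd, and m'_n = (3n² − 2n)/8 if n is even and m'_n = 0 if n is odd. Define the Boolean cumulants b_n = Σ_{π composition of n} (−1)^{r(π)−1} Π_{i} m_{k_i} and the infinitesimal Boolean cumulants b'_n = Σ_{π composition of n} (−1)^{r(π)−1} Σ_{s=1}^{r(π)} m'_{k_s} Π_{i≠s} m_{k_i}, where π = (k_1,…,k_{r(π)}) ranges over compositions of n. Then b_n = 1 if n = 2 and b_n = 0 otherwise; and b'_n = 1 if n = 2, b'_n = 3 if n is even and n ≠ 2, and b'_n = 0 if n is odd. -/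
noncomputable section

open scoped BigOperators

/-- The limiting moments of the anti-trace random matrix model: `m_n = 1` for `n` even,
`0` for `n` odd. -/
def mSeq (n : ℕ) : ℝ := if Even n then 1 else 0

/-- The limiting infinitesimal moments: `m'_n = (3n² − 2n)/8` for `n` even, `0` for `n`
odd. -/
def mSeq' (n : ℕ) : ℝ := if Even n then (3 * (n : ℝ) ^ 2 - 2 * (n : ℝ)) / 8 else 0

/-- The Boolean cumulants obtained from the moments `(m_n)` by the Boolean
moment-cumulant inversion over compositions (interval partitions):
`b_n = Σ_{π composition of n} (−1)^{r(π)−1} Π_i m_{k_i}`. -/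
def bCum (n : ℕ) : ℝ :=
  ∑ c : Composition n,
    (-1 : ℝ) ^ (c.length - 1) * ∏ i : Fin c.length, mSeq (c.blocksFun i)

/-- The infinitesimal Boolean cumulants obtained from `(m_n, m'_n)`:
`b'_n = Σ_{π composition of n} (−1)^{r(π)−1} Σ_s m'_{k_s} Π_{i≠s} m_{k_i}`. -/
def bCum' (n : ℕ) : ℝ :=
  ∑ c : Composition n,
    (-1 : ℝ) ^ (c.length - 1) *
      ∑ s : Fin c.length,
        mSeq' (c.blocksFun s) * ∏ i ∈ Finset.univ.erase s, mSeq (c.blocksFun i)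

/-- A sum over the compositions of `n + 1` splits according to the first block. -/
theorem Composition.sum_succ {M : Type*} [AddCommMonoid M] (f : List ℕ → M) (n : ℕ) :
    ∑ c : Composition (n + 1), f c.blocks =
      ∑ i : Fin (n + 1), ∑ c : Composition (n - i), f ((i + 1) :: c.blocks) := by
  rw [← Fintype.sum_sigma' (fun (i : Fin (n + 1)) (c : Composition (n - i)) =>
    f ((i + 1) :: c.blocks))]
  let e : (Σ i : Fin (n + 1), Composition (n - i)) → Composition (n + 1) := fun p =>
    { blocks := (p.1 + 1) :: p.2.blocks
      blocks_pos := by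
        intro k hk
        rcases List.mem_cons.1 hk with rfl | hk
        · exact Nat.succ_pos _
        · exact p.2.blocks_pos hk
      blocks_sum := by
        have := p.1.2
        rw [List.sum_cons, p.2.blocks_sum]
        omega }
  have he : Function.Bijective e := by
    constructor
    · rintro ⟨i, c⟩ ⟨j, d⟩ h
      have hb : ((i : ℕ) + 1) :: c.blocks = ((j : ℕ) + 1) :: d.blocks :=
        congrArg Composition.blocks h
      obtain ⟨hij, hcd⟩ := List.cons.inj hb
      obtain rfl : i = j := Fin.ext (Nat.succ_injective hij)
      obtain rfl : c = d := Composition.ext hcd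
      rfl
    · intro c
      have hs := c.blocks_sum
      have hp : ∀ k ∈ c.blocks, 0 < k := fun k hk => c.blocks_pos hk
      rcases hc : c.blocks with _ | ⟨a, l⟩
      · simp [hc] at hs
      · rw [hc, List.sum_cons] at hs
        rw [hc] at hp
        have ha : 0 < a := hp a (by simp)
        refine ⟨⟨⟨a - 1, by omega⟩, ⟨l, fun {k} hk => hp k (by simp [hk]), ?_⟩⟩, ?_⟩
        · change l.sum = n - (a - 1)
          omega
        · apply Composition.ext
          rw [hc]
          change (a - 1 + 1) :: l = a :: l
          rw [Nat.sub_add_cancel ha]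
  exact (he.sum_comp fun c : Composition (n + 1) => f c.blocks).symm

/-- The sum over the compositions of `n` of the products of the weights of the blocks. -/
def compositionSum {R : Type*} [CommSemiring R] (w : ℕ → R) (n : ℕ) : R :=
  ∑ c : Composition n, ∏ i : Fin c.length, w (c.blocksFun i)

theorem Composition.prod_blocksFun {R : Type*} [CommMonoid R] (w : ℕ → R) {n : ℕ}
    (c : Composition n) : ∏ i : Fin c.length, w (c.blocksFun i) = (c.blocks.map w).prod := by
  rw [← List.prod_ofFn, ← c.ofFn_blocksFun, List.map_ofFn]
  rfl

theorem compositionSum_zero {R : Type*} [CommSemiring R] (w : ℕ → R) :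
    compositionSum w 0 = 1 := by
  simp [compositionSum, Composition.prod_blocksFun,
    fun c : Composition 0 => c.blocks_eq_nil.2 rfl, composition_card]

theorem compositionSum_succ {R : Type*} [CommSemiring R] (w : ℕ → R) (n : ℕ) :
    compositionSum w (n + 1) =
      ∑ i ∈ Finset.range (n + 1), w (i + 1) * compositionSum w (n - i) := by
  simp only [compositionSum, Composition.prod_blocksFun]
  rw [Composition.sum_succ (fun l => (l.map w).prod),
    ← Fin.sum_univ_eq_sum_range (fun i => w (i + 1) *
      ∑ c : Composition (n - i), (c.blocks.map w).prod)]
  simp [Finset.mul_sum]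

open Polynomial in
/-- The negated moments, perturbed to first order by the negated infinitesimal moments. -/
def momentPoly (k : ℕ) : ℝ[X] := C (-mSeq k) + C (-mSeq' k) * X

theorem bCum_eq_neg_eval {n : ℕ} (hn : 1 ≤ n) :
    bCum n = -(compositionSum momentPoly n).eval 0 := by
  simp only [bCum, compositionSum, Polynomial.eval_finsetSum, Polynomial.eval_prod]
  rw [← Finset.sum_neg_distrib]
  refine Finset.sum_congr rfl fun c _ => ?_
  obtain ⟨r, hr⟩ : ∃ r, c.length = r + 1 :=
    Nat.exists_eq_succ_of_ne_zero (c.length_pos_iff.2 hn).ne'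
  simp [momentPoly, Finset.prod_neg, hr, pow_succ]

theorem bCum'_eq_neg_eval_derivative (n : ℕ) :
    bCum' n = -(compositionSum momentPoly n).derivative.eval 0 := by
  simp only [bCum', compositionSum, Polynomial.derivative_sum, Polynomial.eval_finsetSum,
    Polynomial.derivative_prod_finset, Polynomial.eval_mul, Polynomial.eval_prod]
  rw [← Finset.sum_neg_distrib]
  refine Finset.sum_congr rfl fun c _ => ?_
  rw [Finset.mul_sum, ← Finset.sum_neg_distrib]
  refine Finset.sum_congr rfl fun s _ => ?_
  simp [momentPoly, Finset.prod_neg, Finset.card_erase_of_mem]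
  ring

theorem mSeq_add_two (n : ℕ) : mSeq (n + 2) = mSeq n := by
  simp [mSeq, Nat.even_add]

/-- Convolution with the moments, shifted by one. -/
theorem sum_mSeq_succ_mul_add_two (g : ℕ → ℝ) (n : ℕ) :
    ∑ i ∈ Finset.range (n + 2 + 1), mSeq (i + 1) * g (n + 2 - i) =
      ∑ i ∈ Finset.range (n + 1), mSeq (i + 1) * g (n - i) + g (n + 1) := by
  rw [Finset.sum_range_succ', Finset.sum_range_succ']
  simp only [Nat.add_sub_add_right, add_right_comm _ 1 1, mSeq_add_two]
  simp [mSeq, add_assoc]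

theorem eval_compositionSum_momentPoly_succ (n : ℕ) :
    (compositionSum momentPoly (n + 1)).eval 0 =
      -∑ i ∈ Finset.range (n + 1), mSeq (i + 1) * (compositionSum momentPoly (n - i)).eval 0 := by
  rw [compositionSum_succ, Polynomial.eval_finsetSum, ← Finset.sum_neg_distrib]
  exact Finset.sum_congr rfl fun i _ => by simp [momentPoly]

theorem eval_compositionSum_momentPoly (n : ℕ) :
    (compositionSum momentPoly n).eval 0 = if n = 0 then 1 else if n = 2 then -1 else 0 := by
  match n with
  | 0 => simp [compositionSum_zero]
  | 1 => simp [eval_compositionSum_momentPoly_succ, mSeq]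
  | 2 => simp [eval_compositionSum_momentPoly_succ, Finset.sum_range_succ, mSeq,
      compositionSum_zero]
  | n + 3 =>
    rw [eval_compositionSum_momentPoly_succ,
      sum_mSeq_succ_mul_add_two fun k => (compositionSum momentPoly k).eval 0,
      eval_compositionSum_momentPoly_succ n]
    simp

/-- Convolution of the infinitesimal moments, shifted by one, with the constant terms. -/
theorem sum_mSeq'_succ_mul_eval (n : ℕ) :
    ∑ i ∈ Finset.range (n + 2 + 1),
        mSeq' (i + 1) * (compositionSum momentPoly (n + 2 - i)).eval 0 =
      mSeq' (n + 3) - mSeq' (n + 1) := by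
  rw [Finset.sum_range_succ, Finset.sum_range_succ, Finset.sum_range_succ, Finset.sum_eq_zero]
  · simp [eval_compositionSum_momentPoly]
    ring
  · intro i hi
    have := Finset.mem_range.1 hi
    rw [eval_compositionSum_momentPoly, if_neg (by omega), if_neg (by omega), mul_zero]

theorem eval_derivative_compositionSum_momentPoly_succ (n : ℕ) :
    (compositionSum momentPoly (n + 1)).derivative.eval 0 =
      -∑ i ∈ Finset.range (n + 1),
          mSeq (i + 1) * (compositionSum momentPoly (n - i)).derivative.eval 0 -
        ∑ i ∈ Finset.range (n + 1),
          mSeq' (i + 1) * (compositionSum momentPoly (n - i)).eval 0 := by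
  rw [compositionSum_succ, Polynomial.derivative_sum, Polynomial.eval_finsetSum,
    ← Finset.sum_neg_distrib, ← Finset.sum_sub_distrib]
  refine Finset.sum_congr rfl fun i _ => ?_
  simp [momentPoly]
  ring

theorem eval_derivative_compositionSum_momentPoly_add_three (n : ℕ) :
    (compositionSum momentPoly (n + 3)).derivative.eval 0 =
      ∑ i ∈ Finset.range (n + 1),
          mSeq' (i + 1) * (compositionSum momentPoly (n - i)).eval 0 -
        (mSeq' (n + 3) - mSeq' (n + 1)) := by
  rw [eval_derivative_compositionSum_momentPoly_succ, sum_mSeq'_succ_mul_eval,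
    sum_mSeq_succ_mul_add_two fun k => (compositionSum momentPoly k).derivative.eval 0,
    eval_derivative_compositionSum_momentPoly_succ n]
  ring

theorem eval_derivative_compositionSum_momentPoly (n : ℕ) :
    (compositionSum momentPoly n).derivative.eval 0 =
      if n = 0 then 0 else if n = 2 then -1 else if Even n then -3 else 0 := by
  match n with
  | 0 => simp [compositionSum_zero]
  | 1 => simp [eval_derivative_compositionSum_momentPoly_succ, mSeq, mSeq']
  | 2 =>
    simp [eval_derivative_compositionSum_momentPoly_succ, Finset.sum_range_succ, mSeq, mSeq',
      compositionSum_zero]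
    norm_num
  | 3 =>
    have h : ¬ Even 3 := by decide
    simp [eval_derivative_compositionSum_momentPoly_add_three, mSeq', h]
  | 4 =>
    have h : Even 4 := by decide
    simp [eval_derivative_compositionSum_momentPoly_add_three, Finset.sum_range_succ, mSeq', h,
      compositionSum_zero]
    norm_num
  | n + 5 =>
    rw [eval_derivative_compositionSum_momentPoly_add_three, sum_mSeq'_succ_mul_eval]
    have h3 : Even (n + 3) ↔ ¬ Even n := by grind
    have h5 : Even (n + 5) ↔ ¬ Even n := by grind
    by_cases h : Even n
    · simp [mSeq', h, h3, h5, Nat.even_add_one]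
    · simp [mSeq', h, h3, h5, Nat.even_add_one]
      ring

/-- Theorem: the Boolean cumulants of the anti-trace model are `b₂ = 1` and `b_n = 0`
otherwise; the infinitesimal Boolean cumulants are `b'₂ = 1`, `b'_n = 3` for even
`n ≠ 2`, and `b'_n = 0` for odd `n`. -/
theorem anti_trace_boolean_cumulants :
    ∀ n : ℕ, 1 ≤ n →
      (bCum n = if n = 2 then 1 else 0) ∧
      (bCum' n = if n = 2 then 1 else if Even n then 3 else 0) := by
  intro n hn
  rw [bCum_eq_neg_eval hn, bCum'_eq_neg_eval_derivative, eval_compositionSum_momentPoly,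
    eval_derivative_compositionSum_momentPoly]
  have hn0 : n ≠ 0 := by omega
  constructor <;> split_ifs <;> simp_all
end
end

section
/- For every z ∈ ℂ with Im z > 0, the Cauchy transform of the standard semicircle law, G(z) := ∫_{−2}^{2} (1/(z − t)) · (√(4 − t²)/(2π)) dt, satisfies G(z)² − z·G(z) + 1 = 0 and Im G(z) < 0 (so that G(z) = (z − √(z²−4))/2 for the branch of the square root with √(z²−4) ∼ z at infinity). -/
noncomputable section

open MeasureTheory

/-- The Cauchy transform of the standard semicircle law:
`G(z) = ∫_{−2}^{2} (1/(z−t)) · √(4−t²)/(2π) dt`. -/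
def semicircleCauchy (z : ℂ) : ℂ :=
  ∫ t in (-2 : ℝ)..(2 : ℝ),
    ((Real.sqrt (4 - t ^ 2) / (2 * Real.pi) : ℝ) : ℂ) / (z - (t : ℂ))

theorem sub_ofReal_ne_zero_of_im_pos {z : ℂ} (hz : 0 < z.im) (t : ℝ) : z - (t : ℂ) ≠ 0 := by
  intro h
  have := congrArg Complex.im h
  simp at this
  exact hz.ne' this

/-- Every point of the upper half-plane is `w + w⁻¹` for some `w` in the punctured unit disc. -/
theorem exists_norm_lt_one_add_inv_eq {z : ℂ} (hz : 0 < z.im) :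
    ∃ w : ℂ, w ≠ 0 ∧ ‖w‖ < 1 ∧ w + w⁻¹ = z := by
  obtain ⟨s, hs⟩ := IsAlgClosed.exists_pow_nat_eq (z ^ 2 - 4) two_pos
  have hmul : (z + s) / 2 * ((z - s) / 2) = 1 := by linear_combination -hs / 4
  have h0 := left_ne_zero_of_mul_eq_one hmul
  have h0' := right_ne_zero_of_mul_eq_one hmul
  have hinv := inv_eq_of_mul_eq_one_right hmul
  have hinv' := inv_eq_of_mul_eq_one_left hmul
  rcases lt_trichotomy ‖(z + s) / 2‖ 1 with h | h | h
  · exact ⟨_, h0, h, by rw [hinv]; ring⟩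
  · rw [Complex.inv_eq_conj h] at hinv
    have him := congrArg Complex.im (Complex.add_conj ((z + s) / 2))
    rw [hinv, Complex.ofReal_im, show (z + s) / 2 + (z - s) / 2 = z by ring] at him
    exact absurd him hz.ne'
  · refine ⟨_, h0', ?_, by rw [hinv']; ring⟩
    rw [← hinv, norm_inv]
    exact inv_lt_one_of_one_lt₀ h

theorem im_neg_of_norm_lt_one {w : ℂ} (h0 : w ≠ 0) (h1 : ‖w‖ < 1)
    (hz : 0 < (w + w⁻¹).im) : w.im < 0 := by
  have hn : 0 < Complex.normSq w := Complex.normSq_pos.2 h0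
  have hn1 : Complex.normSq w < 1 := by
    rw [Complex.normSq_eq_norm_sq]; nlinarith [norm_nonneg w]
  rw [Complex.add_im, Complex.inv_im] at hz
  have h : (w.im + -w.im / Complex.normSq w) * Complex.normSq w
      = w.im * (Complex.normSq w - 1) := by field_simp; ring
  have := mul_pos hz hn
  rw [h] at this
  nlinarith

/-- The substitution `t = 2 cos θ` in the Cauchy transform. -/
theorem semicircleCauchy_eq_integral_cos {z : ℂ} (hz : 0 < z.im) :
    semicircleCauchy z = (2 * Real.pi : ℂ)⁻¹ *
      ∫ θ in (0 : ℝ)..Real.pi, 4 * Complex.sin θ ^ 2 / (z - 2 * Complex.cos θ) := by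
  have hcont : Continuous fun t : ℝ =>
      ((Real.sqrt (4 - t ^ 2) / (2 * Real.pi) : ℝ) : ℂ) / (z - (t : ℂ)) :=
    Continuous.div (by fun_prop) (by fun_prop) (sub_ofReal_ne_zero_of_im_pos hz)
  have hsub := intervalIntegral.integral_deriv_smul_comp (a := Real.pi) (b := 0)
    (f := fun θ => 2 * Real.cos θ) (f' := fun θ => 2 * -Real.sin θ)
    (fun θ _ => (Real.hasDerivAt_cos θ).const_mul 2) (by fun_prop) hcont
  simp only [Real.cos_pi, Real.cos_zero, mul_neg, mul_one] at hsub
  rw [semicircleCauchy, ← hsub, intervalIntegral.integral_symm,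
    ← intervalIntegral.integral_neg, ← intervalIntegral.integral_const_mul]
  refine intervalIntegral.integral_congr fun θ hθ => ?_
  rw [Set.uIcc_of_le Real.pi_pos.le] at hθ
  have hsin := Real.sin_nonneg_of_mem_Icc hθ
  have hsqrt : Real.sqrt (4 - (2 * Real.cos θ) ^ 2) = 2 * Real.sin θ := by
    rw [← Real.sqrt_sq (mul_nonneg two_pos.le hsin), mul_pow, mul_pow, Real.sin_sq]
    congr 1
    ring
  have hne := sub_ofReal_ne_zero_of_im_pos hz (2 * Real.cos θ)
  simp only [Function.comp_apply, hsqrt, Complex.real_smul]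
  push_cast at hne ⊢
  field_simp
  ring

theorem integral_zero_pi_sin_sq_div {w : ℂ} (h1 : ‖w‖ < 1) (h0 : w ≠ 0) :
    ∫ θ in (0 : ℝ)..Real.pi, 4 * Complex.sin θ ^ 2 / (w + w⁻¹ - 2 * Complex.cos θ)
      = 2 * Real.pi * w := by
  have hnorm (u : ℂ) (hu : ‖u‖ ≤ 1) : 1 - u * w ≠ 0 := by
    intro h
    have h' : ‖u * w‖ = 1 := by rw [← sub_eq_zero.1 h, norm_one]
    rw [norm_mul] at h'
    nlinarith [norm_nonneg w, norm_nonneg u]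
  have hC : (∮ u in C(0, 1), (u - w)⁻¹ • ((1 - u ^ 2) * w / (1 - u * w)))
      = (2 * Real.pi * Complex.I : ℂ) • ((1 - w ^ 2) * w / (1 - w * w)) := by
    refine DiffContOnCl.circleIntegral_sub_inv_smul ?_ (by simpa using h1)
    refine DifferentiableOn.diffContOnCl_ball (U := Metric.closedBall 0 1) ?_ subset_rfl
    exact DifferentiableOn.div (by fun_prop) (by fun_prop)
      fun u hu => hnorm u (by simpa using hu)
  have hw : (1 - w ^ 2) * w / (1 - w * w) = w := by
    rw [← pow_two, mul_div_cancel_left₀]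
    simpa [pow_two] using hnorm w h1.le
  let g : ℝ → ℂ := fun θ => circleMap 0 1 θ *
    ((circleMap 0 1 θ - w)⁻¹ * ((1 - circleMap 0 1 θ ^ 2) * w / (1 - circleMap 0 1 θ * w)))
  have hunit (θ : ℝ) : ‖circleMap 0 1 θ‖ = 1 := by simp
  have hsubne (u : ℂ) (hu : ‖u‖ = 1) : u - w ≠ 0 := by
    intro h
    rw [sub_eq_zero.1 h] at hu
    exact h1.ne hu
  have hg : Continuous g := by
    have hc := continuous_circleMap 0 1
    refine hc.mul (Continuous.mul ?_ ?_)
    · exact (hc.sub continuous_const).inv₀ fun θ => hsubne _ (hunit θ)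
    · exact Continuous.div (by fun_prop) (by fun_prop) fun θ => hnorm _ (hunit θ).le
  have hgint : ∫ θ in (0 : ℝ)..2 * Real.pi, g θ = 2 * Real.pi * w := by
    rw [hw, circleIntegral] at hC
    have hI : ∫ θ in (0 : ℝ)..2 * Real.pi, Complex.I * g θ
        = Complex.I * (2 * Real.pi * w) := by
      rw [smul_eq_mul] at hC
      rw [show Complex.I * (2 * Real.pi * w) = 2 * Real.pi * Complex.I * w by ring, ← hC]
      refine intervalIntegral.integral_congr fun θ _ => ?_
      simp only [deriv_circleMap, smul_eq_mul, g]
      ring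
    rw [intervalIntegral.integral_const_mul] at hI
    exact mul_left_cancel₀ Complex.I_ne_zero hI
  have hsymm : ∫ θ in (0 : ℝ)..Real.pi, g (2 * Real.pi - θ)
      = ∫ θ in Real.pi..2 * Real.pi, g θ := by
    rw [intervalIntegral.integral_comp_sub_left]
    congr 1 <;> ring
  have hg' : Continuous fun θ => g (2 * Real.pi - θ) := hg.comp (by fun_prop)
  rw [← hgint, ← intervalIntegral.integral_add_adjacent_intervals
    (hg.intervalIntegrable 0 Real.pi) (hg.intervalIntegrable Real.pi _), ← hsymm,
    ← intervalIntegral.integral_add (hg.intervalIntegrable _ _)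
      (hg'.intervalIntegrable _ _)]
  refine intervalIntegral.integral_congr fun θ _ => ?_
  have hu : circleMap 0 1 θ = Complex.exp (θ * Complex.I) := by simp [circleMap]
  have hu' : circleMap 0 1 (2 * Real.pi - θ) = (circleMap 0 1 θ)⁻¹ := by
    rw [hu, ← Complex.exp_neg]
    simp only [circleMap]
    push_cast
    rw [sub_mul, Complex.exp_sub, Complex.exp_two_pi_mul_I, Complex.exp_neg]
    simp
  have hcos : 2 * Complex.cos θ = circleMap 0 1 θ + (circleMap 0 1 θ)⁻¹ := by
    rw [hu, ← Complex.exp_neg, Complex.two_cos, neg_mul]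
  have hsin : 4 * Complex.sin θ ^ 2 = 4 - (circleMap 0 1 θ + (circleMap 0 1 θ)⁻¹) ^ 2 := by
    rw [← hcos, Complex.sin_sq]
    ring
  simp only [g, hu', hsin, hcos]
  have hne := hsubne _ (hunit θ)
  have hne' := hnorm _ (hunit θ).le
  have hu0 : circleMap 0 1 θ ≠ 0 := by
    rw [← norm_ne_zero_iff, hunit]; exact one_ne_zero
  generalize circleMap 0 1 θ = u at *
  have e1 : w + w⁻¹ - (u + u⁻¹) = (u - w) * (1 - u * w) / (u * w) := by field_simp; ring
  have e2 : u⁻¹ - w = (1 - u * w) / u := by field_simp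
  have e3 : 1 - u⁻¹ * w = (u - w) / u := by field_simp
  rw [e1, e2, e3]
  field_simp
  ring

/-- Theorem: for `Im z > 0`, the Cauchy transform of the standard semicircle law
satisfies the quadratic equation `G(z)² − z·G(z) + 1 = 0` and `Im G(z) < 0`, i.e.
`G(z) = (z − √(z²−4))/2` for the branch of the square root asymptotic to `z` at
infinity. -/
theorem semicircle_cauchy_transform (z : ℂ) (hz : 0 < z.im) :
    semicircleCauchy z ^ 2 - z * semicircleCauchy z + 1 = 0 ∧
    (semicircleCauchy z).im < 0 := by
  obtain ⟨w, h0, h1, rfl⟩ := exists_norm_lt_one_add_inv_eq hz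
  have hG : semicircleCauchy (w + w⁻¹) = w := by
    rw [semicircleCauchy_eq_integral_cos hz, integral_zero_pi_sin_sq_div h1 h0]
    have := Real.pi_ne_zero
    field_simp
  rw [hG]
  refine ⟨?_, im_neg_of_norm_lt_one h0 h1 hz⟩
  field_simp
  ring
end
end

section
/- For every z ∈ ℂ with Im z > 0, the Cauchy transform of the arcsine law on (−√2,√2), G(z) := ∫_{−√2}^{√2} (1/(z − t)) · (1/(π√(2 − t²))) dt, satisfies (z² − 2)·G(z)² = 1 and Im G(z) < 0 (so that G(z) = 1/√(z² − 2) for the branch of the square root with √(z²−2) ∼ z at infinity). -/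
noncomputable section

open MeasureTheory

/-- The Cauchy transform of the arcsine law on `(−√2, √2)`:
`G(z) = ∫_{−√2}^{√2} (1/(z−t)) · 1/(π√(2−t²)) dt`. -/
def arcsineCauchy (z : ℂ) : ℂ :=
  ∫ t in (-(Real.sqrt 2))..(Real.sqrt 2),
    ((1 / (Real.pi * Real.sqrt (2 - t ^ 2)) : ℝ) : ℂ) / (z - (t : ℂ))

/-- Every point of the upper half-plane is `(r + r⁻¹) / √2` for some `r` in the punctured unit
disc (the inverse Joukowsky map), written without division. -/
lemma exists_norm_lt_one_joukowsky (z : ℂ) (hz : 0 < z.im) :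
    ∃ r : ℂ, ‖r‖ < 1 ∧ r ≠ 0 ∧ r ^ 2 + 1 = (Real.sqrt 2 : ℂ) * z * r := by
  have h2 : (Real.sqrt 2 : ℂ) ^ 2 = 2 := by
    rw [← Complex.ofReal_pow, Real.sq_sqrt (by norm_num)]; norm_num
  obtain ⟨s, hs⟩ := IsAlgClosed.exists_pow_nat_eq (z ^ 2 - 2) (n := 2) (by norm_num)
  set a : ℂ := (Real.sqrt 2 : ℂ) with ha
  obtain ⟨p, hp⟩ : ∃ p : ℂ, p = a * (z + s) / 2 := ⟨_, rfl⟩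
  obtain ⟨q, hq⟩ : ∃ q : ℂ, q = a * (z - s) / 2 := ⟨_, rfl⟩
  have hpq : p * q = 1 := by
    rw [hp, hq]
    linear_combination (z ^ 2 - s ^ 2) / 4 * h2 - hs / 2
  have hadd : p + q = a * z := by rw [hp, hq]; ring
  have hp0 : p ≠ 0 := left_ne_zero_of_mul_eq_one hpq
  have hq0 : q ≠ 0 := right_ne_zero_of_mul_eq_one hpq
  have hn : ‖p‖ * ‖q‖ = 1 := by rw [← norm_mul, hpq, norm_one]
  have hp1 : ‖p‖ ≠ 1 := by
    intro h
    have hc : q = (starRingEnd ℂ) p := by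
      rw [← Complex.inv_eq_conj h]
      exact eq_inv_of_mul_eq_one_right hpq
    have him := congrArg Complex.im hadd
    rw [hc, ha, Complex.im_ofReal_mul, Complex.add_im, Complex.conj_im, add_neg_cancel] at him
    exact (mul_pos (by positivity : 0 < Real.sqrt 2) hz).ne him
  rcases lt_or_gt_of_ne hp1 with h | h
  · exact ⟨p, h, hp0, by linear_combination p * hadd - hpq⟩
  · refine ⟨q, ?_, hq0, by linear_combination q * hadd - hpq⟩
    have := norm_pos_iff.2 hq0
    nlinarith

lemma one_sub_mul_exp_mem_slitPlane {r : ℂ} (hr : ‖r‖ < 1) {θ : ℂ} (hθ : θ.re = 0) :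
    1 - r * Complex.exp θ ∈ Complex.slitPlane := by
  have h : ‖r * Complex.exp θ‖ < 1 := by
    rw [norm_mul, Complex.norm_exp, hθ, Real.exp_zero, mul_one]; exact hr
  left
  have := Complex.re_le_norm (r * Complex.exp θ)
  rw [Complex.sub_re, Complex.one_re]
  linarith

/-- A primitive of the Poisson kernel `(1 - r²) / (1 - 2 r cos θ + r²)`. -/
def poissonPrimitive (r : ℂ) (θ : ℝ) : ℂ :=
  θ + Complex.I * (Complex.log (1 - r * Complex.exp (θ * Complex.I))
    - Complex.log (1 - r * Complex.exp (-(θ * Complex.I))))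

lemma hasDerivAt_poissonPrimitive {r : ℂ} (hr : ‖r‖ < 1) (θ : ℝ) :
    HasDerivAt (poissonPrimitive r)
      ((1 - r ^ 2) / (1 - 2 * r * (Real.cos θ : ℂ) + r ^ 2)) θ := by
  have hm₁ : 1 - r * Complex.exp (θ * Complex.I) ∈ Complex.slitPlane :=
    one_sub_mul_exp_mem_slitPlane hr (by simp)
  have hm₂ : 1 - r * Complex.exp (-(θ * Complex.I)) ∈ Complex.slitPlane :=
    one_sub_mul_exp_mem_slitPlane hr (by simp)
  have hid : HasDerivAt (fun x : ℝ ↦ (x : ℂ)) 1 θ := Complex.ofRealCLM.hasDerivAt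
  have hI := hid.mul_const Complex.I
  have h₁ := ((hI.cexp.const_mul r).const_sub 1).clog_real hm₁
  have h₂ := ((hI.neg.cexp.const_mul r).const_sub 1).clog_real hm₂
  refine (hid.add ((h₁.sub h₂).const_mul Complex.I)).congr_deriv ?_
  have hn₁ := Complex.slitPlane_ne_zero hm₁
  have hn₂ := Complex.slitPlane_ne_zero hm₂
  have hcos : 2 * (Real.cos θ : ℂ)
      = Complex.exp (θ * Complex.I) + Complex.exp (-(θ * Complex.I)) := by
    rw [Complex.ofReal_cos, Complex.cos, neg_mul]; ring
  have hexp : Complex.exp (θ * Complex.I) * Complex.exp (-(θ * Complex.I)) = 1 := by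
    rw [← Complex.exp_add, add_neg_cancel, Complex.exp_zero]
  have hden : 1 - 2 * r * (Real.cos θ : ℂ) + r ^ 2
      = (1 - r * Complex.exp (θ * Complex.I)) * (1 - r * Complex.exp (-(θ * Complex.I))) := by
    linear_combination -r * hcos - r ^ 2 * hexp
  rw [hden]
  simp only [Pi.neg_apply]
  generalize Complex.exp (θ * Complex.I) = u at *
  generalize Complex.exp (-(θ * Complex.I)) = v at *
  field_simp
  rw [Complex.I_sq]
  linear_combination -r ^ 2 * hexp

lemma poissonPrimitive_pi_sub_zero (r : ℂ) :
    poissonPrimitive r Real.pi - poissonPrimitive r 0 = Real.pi := by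
  simp [poissonPrimitive, Complex.exp_neg]

lemma hasDerivAt_arccos_div_sqrt_two {t : ℝ} (ht : t ∈ Set.Ioo (-Real.sqrt 2) (Real.sqrt 2)) :
    HasDerivAt (fun x ↦ Real.arccos (x / Real.sqrt 2)) (-(1 / Real.sqrt (2 - t ^ 2))) t := by
  have hs : 0 < Real.sqrt 2 := by positivity
  have h₁ : t / Real.sqrt 2 ≠ -1 := by
    rw [Ne, div_eq_iff hs.ne']; linarith [ht.1]
  have h₂ : t / Real.sqrt 2 ≠ 1 := by
    rw [Ne, div_eq_iff hs.ne']; linarith [ht.2]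
  refine ((Real.hasDerivAt_arccos h₁ h₂).comp t ((hasDerivAt_id t).div_const _)).congr_deriv ?_
  have : Real.sqrt (2 - t ^ 2) = Real.sqrt 2 * Real.sqrt (1 - (t / Real.sqrt 2) ^ 2) := by
    rw [← Real.sqrt_mul (by norm_num), div_pow, Real.sq_sqrt (by norm_num)]
    congr 1; ring
  rw [this, neg_mul, one_div_mul_one_div_rev]

lemma intervalIntegrable_one_div_sqrt_two_sub_sq :
    IntervalIntegrable (fun t : ℝ ↦ 1 / Real.sqrt (2 - t ^ 2)) volume
      (-Real.sqrt 2) (Real.sqrt 2) := by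
  have hs : 0 < Real.sqrt 2 := by positivity
  refine intervalIntegral.intervalIntegrable_deriv_of_nonneg
    (g' := fun t : ℝ ↦ 1 / Real.sqrt (2 - t ^ 2))
    (g := fun x ↦ -Real.arccos (x / Real.sqrt 2))
    (Real.continuous_arccos.comp (continuous_id.div_const _)).neg.continuousOn
    (fun t ht ↦ ?_) (fun t _ ↦ (by positivity : 0 ≤ 1 / Real.sqrt (2 - t ^ 2)))
  rw [min_eq_left (by linarith), max_eq_right (by linarith)] at ht
  exact (hasDerivAt_arccos_div_sqrt_two ht).neg.congr_deriv (neg_neg _)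

lemma arcsineCauchy_eq {z r : ℂ} (hz : 0 < z.im) (hr : ‖r‖ < 1) (hr0 : r ≠ 0)
    (h : r ^ 2 + 1 = (Real.sqrt 2 : ℂ) * z * r) :
    arcsineCauchy z = Real.sqrt 2 * r / (1 - r ^ 2) := by
  have hs : 0 < Real.sqrt 2 := by positivity
  have hsC : (Real.sqrt 2 : ℂ) ≠ 0 := by exact_mod_cast hs.ne'
  have hpi : (Real.pi : ℂ) ≠ 0 := by exact_mod_cast Real.pi_ne_zero
  have hzt (t : ℝ) : z - t ≠ 0 := fun h0 ↦ by
    have := congrArg Complex.im h0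
    simp at this
    exact hz.ne' this
  have hr2 : 1 - r ^ 2 ≠ 0 := fun h0 ↦ by
    have : ‖r ^ 2‖ = 1 := by rw [← sub_eq_zero.1 h0, norm_one]
    rw [norm_pow] at this
    nlinarith [norm_nonneg r]
  set c : ℂ := Real.sqrt 2 * r / (1 - r ^ 2) with hc
  have hint : IntervalIntegrable
      (fun t : ℝ ↦ ((1 / (Real.pi * Real.sqrt (2 - t ^ 2)) : ℝ) : ℂ) / (z - (t : ℂ))) volume
      (-Real.sqrt 2) (Real.sqrt 2) := by
    have hcont : Continuous fun t : ℝ ↦ 1 / ((Real.pi : ℂ) * (z - t)) :=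
      continuous_const.div (by fun_prop) fun t ↦ mul_ne_zero hpi (hzt t)
    have hdens : IntervalIntegrable (fun t : ℝ ↦ ((1 / Real.sqrt (2 - t ^ 2) : ℝ) : ℂ)) volume
        (-Real.sqrt 2) (Real.sqrt 2) :=
      ⟨intervalIntegrable_one_div_sqrt_two_sub_sq.1.ofReal,
        intervalIntegrable_one_div_sqrt_two_sub_sq.2.ofReal⟩
    refine (hdens.mul_continuousOn
      hcont.continuousOn).congr fun t _ ↦ ?_
    push_cast
    simp only [div_eq_mul_inv, mul_inv, one_mul]
    ring
  have hderiv (t : ℝ) (ht : t ∈ Set.Ioo (-Real.sqrt 2) (Real.sqrt 2)) :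
      HasDerivAt (fun x ↦ -(c / Real.pi) * poissonPrimitive r (Real.arccos (x / Real.sqrt 2)))
        (((1 / (Real.pi * Real.sqrt (2 - t ^ 2)) : ℝ) : ℂ) / (z - (t : ℂ))) t := by
    refine (((hasDerivAt_poissonPrimitive hr _).scomp t
      (hasDerivAt_arccos_div_sqrt_two ht)).const_mul _).congr_deriv ?_
    have hcos : Real.cos (Real.arccos (t / Real.sqrt 2)) = t / Real.sqrt 2 :=
      Real.cos_arccos (by rw [le_div_iff₀ hs]; linarith [ht.1])
        (by rw [div_le_one hs]; exact ht.2.le)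
    have hsq : (Real.sqrt 2 : ℂ) ^ 2 = 2 := by
      rw [← Complex.ofReal_pow, Real.sq_sqrt (by norm_num)]; norm_num
    have hker : 1 - 2 * r * ((t / Real.sqrt 2 : ℝ) : ℂ) + r ^ 2 = Real.sqrt 2 * r * (z - t) := by
      push_cast
      field_simp
      linear_combination (Real.sqrt 2 : ℂ) * h + r * t * hsq
    have hw : (Real.sqrt (2 - t ^ 2) : ℂ) ≠ 0 := by
      have : 0 < 2 - t ^ 2 := by
        have := Real.sq_sqrt (show (0 : ℝ) ≤ 2 by norm_num)
        nlinarith [ht.1, ht.2]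
      exact_mod_cast (Real.sqrt_pos.2 this).ne'
    have := hzt t
    rw [hcos, hker, hc, Complex.real_smul]
    push_cast
    field_simp
  rw [arcsineCauchy, intervalIntegral.integral_eq_sub_of_hasDerivAt_of_le (by linarith)
    ?_ hderiv hint]
  · have := poissonPrimitive_pi_sub_zero r
    rw [neg_div, div_self hs.ne', Real.arccos_neg_one, Real.arccos_one, ← mul_sub, ← neg_sub,
      this]
    field_simp
  · have : Continuous (poissonPrimitive r) :=
      continuous_iff_continuousAt.2 fun θ ↦ (hasDerivAt_poissonPrimitive hr θ).continuousAt
    exact (continuous_const.mul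
      (this.comp (Real.continuous_arccos.comp (continuous_id.div_const _)))).continuousOn

/-- Theorem: for `Im z > 0`, the Cauchy transform of the arcsine law on `(−√2, √2)` (the
monotone central limit law) satisfies `(z² − 2)·G(z)² = 1` and `Im G(z) < 0`, i.e.
`G(z) = 1/√(z²−2)` for the branch of the square root asymptotic to `z` at infinity. -/
theorem arcsine_cauchy_transform (z : ℂ) (hz : 0 < z.im) :
    (z ^ 2 - 2) * arcsineCauchy z ^ 2 = 1 ∧ (arcsineCauchy z).im < 0 := by
  obtain ⟨r, hr, hr0, h⟩ := exists_norm_lt_one_joukowsky z hz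
  have hG := arcsineCauchy_eq hz hr hr0 h
  have hs : 0 < Real.sqrt 2 := by positivity
  have hsq : (Real.sqrt 2 : ℂ) ^ 2 = 2 := by
    rw [← Complex.ofReal_pow, Real.sq_sqrt (by norm_num)]; norm_num
  have hr2 : 1 - r ^ 2 ≠ 0 := fun h0 ↦ by
    have : ‖r ^ 2‖ = 1 := by rw [← sub_eq_zero.1 h0, norm_one]
    rw [norm_pow] at this
    nlinarith [norm_nonneg r]
  have hN : Complex.normSq r < 1 := by
    rw [Complex.normSq_eq_norm_sq]; nlinarith [norm_nonneg r]
  have hN0 : 0 < Complex.normSq r := Complex.normSq_pos.2 hr0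
  refine ⟨?_, ?_⟩
  · rw [hG]
    field_simp
    linear_combination (-(r ^ 2 + 1) - (Real.sqrt 2 : ℂ) * z * r) * h - 2 * r ^ 2 * hsq
  · have key : (Real.sqrt 2 * z.im) * Complex.normSq r = r.im * (Complex.normSq r - 1) := by
      have h' : r * Complex.normSq r + (starRingEnd ℂ) r
          = (Real.sqrt 2 : ℂ) * z * Complex.normSq r := by
        rw [← Complex.mul_conj]; linear_combination (starRingEnd ℂ) r * h
      have := congrArg Complex.im h'
      simp at this
      linarith
    have him : r.im < 0 := by
      have : 0 < (Real.sqrt 2 * z.im) * Complex.normSq r := by positivity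
      nlinarith
    have hre : arcsineCauchy z
        = ((Real.sqrt 2 / Complex.normSq (1 - r ^ 2) : ℝ) : ℂ)
          * (r - Complex.normSq r * (starRingEnd ℂ) r) := by
      have hc : (starRingEnd ℂ) (1 - r ^ 2) ≠ 0 := (map_ne_zero _).2 hr2
      rw [hG]
      push_cast
      rw [← Complex.mul_conj, ← Complex.mul_conj]
      field_simp
      simp only [map_sub, map_one, map_pow]
    have hpos : 0 < Real.sqrt 2 / Complex.normSq (1 - r ^ 2) :=
      div_pos hs (Complex.normSq_pos.2 hr2)
    rw [hre, Complex.im_ofReal_mul]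
    refine mul_neg_of_pos_of_neg hpos ?_
    simp
    nlinarith
end
end

section
/- Let G(z) = ∫_{−2}^{2} (1/(z − t)) · (√(4 − t²)/(2π)) dt be the Cauchy transform of the standard semicircle law, defined for Im z > 0. Then for every z ∈ ℂ with Im z > 0, the function w ↦ w·G(w) is complex differentiable at z and −(1/2)·(d/dz)( z·G(z) ) = ∫_{−2}^{2} (1/(z − t)) · ( (t²/2 − 1) / (π√(4 − t²)) ) dt. (Equivalently, the infinitesimal Cauchy transform g(z) = −(α/2)(d/dz)(zG(z)) of the infinitesimal free central limit is the Cauchy transform of the signed measure α(μ₁ − μ₂), where dμ₁(t) = (t²/(2π√(4−t²)))·1_{(−2,2)}(t)dt and dμ₂(t) = (1/(π√(4−t²)))·1_{(−2,2)}(t)dt.) -/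
noncomputable section

open MeasureTheory

theorem intervalIntegrable_inv_sqrt_four_sub_sq :
    IntervalIntegrable (fun t : ℝ => (Real.sqrt (4 - t ^ 2))⁻¹) volume (-2) 2 := by
  refine intervalIntegral.intervalIntegrable_deriv_of_nonneg
    (g := fun t => Real.arcsin (t / 2)) ?_ ?_ ?_
  · exact (Real.continuous_arcsin.comp (continuous_id.div_const 2)).continuousOn
  · intro t ht
    rw [min_eq_left (by norm_num), max_eq_right (by norm_num)] at ht
    obtain ⟨h1, h2⟩ := ht
    have h := (Real.hasDerivAt_arcsin (x := t / 2) (by linarith) (by linarith)).comp t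
      ((hasDerivAt_id t).div_const 2)
    refine h.congr_deriv ?_
    have h4 : (4 : ℝ) - t ^ 2 = 2 ^ 2 * (1 - (t / 2) ^ 2) := by ring
    rw [h4, Real.sqrt_mul (by norm_num), Real.sqrt_sq (by norm_num), mul_inv]
    ring
  · intro t _
    positivity

theorem sub_ofReal_ne_zero_of_im_pos_s17 {w : ℂ} (hw : 0 < w.im) (t : ℝ) : w - (t : ℂ) ≠ 0 := by
  intro h
  have := congrArg Complex.im h
  simp at this
  exact hw.ne' this

theorem hasDerivAt_mul_semicircleCauchy {z : ℂ} (hz : 0 < z.im) :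
    HasDerivAt (fun w => w * semicircleCauchy w)
      (∫ t in (-2 : ℝ)..2, -((t * (Real.sqrt (4 - t ^ 2) / (2 * Real.pi)) : ℝ) : ℂ) /
        (z - (t : ℂ)) ^ 2) z := by
  have him : ∀ w ∈ Metric.ball z (z.im / 2), z.im / 2 < w.im := by
    intro w hw
    rw [Metric.mem_ball, dist_eq_norm] at hw
    have h := (Complex.abs_im_le_norm (w - z)).trans_lt hw
    rw [Complex.sub_im, abs_lt] at h
    linarith [h.1]
  have hne : ∀ w ∈ Metric.ball z (z.im / 2), ∀ t : ℝ, w - (t : ℂ) ≠ 0 := fun w hw =>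
    sub_ofReal_ne_zero_of_im_pos_s17 ((half_pos hz).trans (him w hw))
  have hzb : z ∈ Metric.ball z (z.im / 2) := Metric.mem_ball_self (half_pos hz)
  have hcont : ∀ w ∈ Metric.ball z (z.im / 2), Continuous fun t : ℝ =>
      w * (((Real.sqrt (4 - t ^ 2) / (2 * Real.pi) : ℝ) : ℂ) / (w - (t : ℂ))) := fun w hw =>
    continuous_const.mul (Continuous.div (by fun_prop) (by fun_prop) (hne w hw))
  have key := intervalIntegral.hasDerivAt_integral_of_dominated_loc_of_deriv_le (μ := volume)
    (a := (-2 : ℝ)) (b := 2) (x₀ := z) (s := Metric.ball z (z.im / 2))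
    (F := fun w t => w * (((Real.sqrt (4 - t ^ 2) / (2 * Real.pi) : ℝ) : ℂ) / (w - (t : ℂ))))
    (F' := fun w t => -((t * (Real.sqrt (4 - t ^ 2) / (2 * Real.pi)) : ℝ) : ℂ) /
        (w - (t : ℂ)) ^ 2)
    (bound := fun t => |t * (Real.sqrt (4 - t ^ 2) / (2 * Real.pi))| / (z.im / 2) ^ 2)
    (Metric.ball_mem_nhds z (half_pos hz))
    (Filter.eventually_of_mem (Metric.ball_mem_nhds z (half_pos hz)) fun w hw =>
      (hcont w hw).aestronglyMeasurable)
    ((hcont z hzb).intervalIntegrable _ _)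
    (Continuous.aestronglyMeasurable
      (Continuous.div (by fun_prop) (by fun_prop) fun t => pow_ne_zero 2 (hne z hzb t)))
    (Filter.Eventually.of_forall fun t _ w hw => ?_)
    (Continuous.intervalIntegrable (by fun_prop) _ _)
    (Filter.Eventually.of_forall fun t _ w hw => ?_)
  · refine key.2.congr_of_eventuallyEq (Filter.Eventually.of_forall fun w => ?_)
    simp only [semicircleCauchy, intervalIntegral.integral_const_mul]
  · rw [norm_div, norm_neg, Complex.norm_real, Real.norm_eq_abs, norm_pow]
    have h : z.im / 2 ≤ ‖w - (t : ℂ)‖ := by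
      have h := (le_abs_self _).trans (Complex.abs_im_le_norm (w - (t : ℂ)))
      rw [Complex.sub_im, Complex.ofReal_im, sub_zero] at h
      exact (him w hw).le.trans h
    have := half_pos hz
    gcongr
  · have hw0 := hne w hw t
    have h := (hasDerivAt_id w).mul ((hasDerivAt_const w
      ((Real.sqrt (4 - t ^ 2) / (2 * Real.pi) : ℝ) : ℂ)).div
      ((hasDerivAt_id w).sub_const (t : ℂ)) hw0)
    refine h.congr_deriv ?_
    simp only [id, Pi.div_apply, Complex.ofReal_mul]
    generalize ((Real.sqrt (4 - t ^ 2) / (2 * Real.pi) : ℝ) : ℂ) = A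
    field_simp
    ring

theorem hasDerivAt_mul_sqrt_four_sub_sq_div {t : ℝ} (ht : t ∈ Set.Ioo (-2 : ℝ) 2) :
    HasDerivAt (fun t : ℝ => t * (Real.sqrt (4 - t ^ 2) / (2 * Real.pi)))
      (-2 * ((t ^ 2 / 2 - 1) / (Real.pi * Real.sqrt (4 - t ^ 2)))) t := by
  have hpos : 0 < 4 - t ^ 2 := by nlinarith [ht.1, ht.2]
  have h := (hasDerivAt_id t).mul
    ((((hasDerivAt_pow 2 t).const_sub 4).sqrt hpos.ne').div_const (2 * Real.pi))
  refine h.congr_deriv ?_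
  have hs := Real.sqrt_pos.mpr hpos
  have hsq := Real.sq_sqrt hpos.le
  have := Real.pi_pos
  simp only [id]
  field_simp
  rw [hsq]
  norm_num
  ring

theorem integral_mul_semicircle_div_sq {z : ℂ} (hz : 0 < z.im) :
    ∫ t in (-2 : ℝ)..2, ((t * (Real.sqrt (4 - t ^ 2) / (2 * Real.pi)) : ℝ) : ℂ) /
        (z - (t : ℂ)) ^ 2 =
      2 * ∫ t in (-2 : ℝ)..2,
        (((t ^ 2 / 2 - 1) / (Real.pi * Real.sqrt (4 - t ^ 2)) : ℝ) : ℂ) / (z - (t : ℂ)) := by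
  have hne := sub_ofReal_ne_zero_of_im_pos_s17 hz
  have hint₁ : IntervalIntegrable (fun t : ℝ =>
      ((t * (Real.sqrt (4 - t ^ 2) / (2 * Real.pi)) : ℝ) : ℂ) / (z - (t : ℂ)) ^ 2)
      volume (-2) 2 :=
    (Continuous.div (by fun_prop) (by fun_prop)
      fun t => pow_ne_zero 2 (hne t)).intervalIntegrable _ _
  have hint₂ : IntervalIntegrable (fun t : ℝ =>
      (((t ^ 2 / 2 - 1) / (Real.pi * Real.sqrt (4 - t ^ 2)) : ℝ) : ℂ) / (z - (t : ℂ)))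
      volume (-2) 2 := by
    have h : IntervalIntegrable (fun t : ℝ => (((Real.sqrt (4 - t ^ 2))⁻¹ : ℝ) : ℂ))
        volume (-2) 2 := by
      have h := intervalIntegrable_inv_sqrt_four_sub_sq
      exact ⟨h.1.ofReal, h.2.ofReal⟩
    have hc : Continuous fun t : ℝ => (((t ^ 2 / 2 - 1) / Real.pi : ℝ) : ℂ) / (z - (t : ℂ)) :=
      Continuous.div (by fun_prop) (by fun_prop) hne
    refine (h.continuousOn_mul hc.continuousOn).congr fun t _ => ?_
    push_cast
    rw [div_mul_eq_div_div]
    ring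
  have hderiv : ∀ t ∈ Set.Ioo (-2 : ℝ) 2, HasDerivAt (fun t : ℝ =>
      ((t * (Real.sqrt (4 - t ^ 2) / (2 * Real.pi)) : ℝ) : ℂ) / (z - (t : ℂ)))
      (((t * (Real.sqrt (4 - t ^ 2) / (2 * Real.pi)) : ℝ) : ℂ) / (z - (t : ℂ)) ^ 2 -
        2 * ((((t ^ 2 / 2 - 1) / (Real.pi * Real.sqrt (4 - t ^ 2)) : ℝ) : ℂ) /
          (z - (t : ℂ)))) t := by
    intro t ht
    have h := (hasDerivAt_mul_sqrt_four_sub_sq_div ht).ofReal_comp.div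
      ((hasDerivAt_id t).ofReal_comp.const_sub z) (hne t)
    refine h.congr_deriv ?_
    have h0 := hne t
    rw [Complex.ofReal_mul (-2)]
    generalize (((t ^ 2 / 2 - 1) / (Real.pi * Real.sqrt (4 - t ^ 2)) : ℝ) : ℂ) = A
    generalize ((t * (Real.sqrt (4 - t ^ 2) / (2 * Real.pi)) : ℝ) : ℂ) = B
    simp only [id, Complex.ofReal_one]
    push_cast
    field_simp
    ring
  have hftc := intervalIntegral.integral_eq_sub_of_hasDerivAt_of_le (by norm_num)
    (Continuous.div (by fun_prop) (by fun_prop) hne).continuousOn hderiv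
    (hint₁.sub (hint₂.const_mul 2))
  rw [intervalIntegral.integral_sub hint₁ (hint₂.const_mul 2),
    intervalIntegral.integral_const_mul] at hftc
  refine sub_eq_zero.mp (hftc.trans ?_)
  norm_num


/-- Theorem: for `Im z > 0`, the function `w ↦ w·G(w)` (with `G` the Cauchy transform of
the standard semicircle law) is complex differentiable at `z`, and
`−(1/2)·(d/dz)(z·G(z)) = ∫_{−2}^{2} (1/(z−t)) · (t²/2 − 1)/(π√(4−t²)) dt`, i.e. the
infinitesimal Cauchy transform of the infinitesimal free CLT (with `α = 1`) is the
Cauchy transform of the signed measure `μ₁ − μ₂`. -/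
theorem infinitesimal_free_clt_cauchy_transform (z : ℂ) (hz : 0 < z.im) :
    DifferentiableAt ℂ (fun w => w * semicircleCauchy w) z ∧
    -(1 / 2 : ℂ) * deriv (fun w => w * semicircleCauchy w) z =
      ∫ t in (-2 : ℝ)..(2 : ℝ),
        (((t ^ 2 / 2 - 1) / (Real.pi * Real.sqrt (4 - t ^ 2)) : ℝ) : ℂ) / (z - (t : ℂ)) := by
  have h := hasDerivAt_mul_semicircleCauchy hz
  refine ⟨h.differentiableAt, ?_⟩
  rw [h.deriv]
  simp only [neg_div, intervalIntegral.integral_neg]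
  rw [integral_mul_semicircle_div_sq hz]
  ring
end
end
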